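/- (Derived scheme for the discrete curvature and flux.) Let U^n : ℤ → ℝ, n = 0,…,N, satisfy the backward explicit scheme, and define V_i^n := (δ_h²U^n)_i and W_i^n := F(V_i^n). Then for all 0 ≤ n < N and all i ∈ ℤ: (i) V_i^n = V_i^{n+1} + (Δt/2)·(W_{i+1}^{n+1} − 2W_i^{n+1} + W_{i−1}^{n+1})/h²; (ii) σ²(W_i^{n+1})·W_i^n = σ²(W_i^n)·(W_i^{n+1} + (Δt·σ²(W_i^{n+1})/2)·(W_{i+1}^{n+1} − 2W_i^{n+1} + W_{i−1}^{n+1})/h²); and (iii) W^n = T(W^{n+1}). -/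

import Mathlib

/-- Bang-bang volatility: `σ²(z) = σ̄²` if `z ≥ 0`, else `σ̲²`. -/
noncomputable def sig2 (σlo σhi z : ℝ) : ℝ := if 0 ≤ z then σhi ^ 2 else σlo ^ 2

/-- Nonlinear flux `F(v) = σ²(v) · v`. -/
noncomputable def Fflux (σlo σhi v : ℝ) : ℝ := sig2 σlo σhi v * v

/-- `B_i(W) = W_i + (Δt·σ²(W_i)/2)·(W_{i+1} − 2W_i + W_{i−1})/h²`. -/
noncomputable def Bmap (σlo σhi h Δt : ℝ) (W : ℤ → ℝ) (i : ℤ) : ℝ :=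
  W i + Δt * sig2 σlo σhi (W i) / 2 * ((W (i + 1) - 2 * W i + W (i - 1)) / h ^ 2)

/-- One-step map of the `w`-scheme: `T(W)_i = F(B_i(W))/σ²(W_i)`. -/
noncomputable def Tmap (σlo σhi h Δt : ℝ) (W : ℤ → ℝ) (i : ℤ) : ℝ :=
  Fflux σlo σhi (Bmap σlo σhi h Δt W i) / sig2 σlo σhi (W i)

theorem sig2_pos {σlo σhi : ℝ} (hlo : 0 < σlo) (hσ : σlo ≤ σhi) (z : ℝ) :
    0 < sig2 σlo σhi z := by
  have hhi : 0 < σhi := hlo.trans_le hσ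
  unfold sig2
  split_ifs <;> positivity

theorem sig2_mul_of_pos (σlo σhi : ℝ) {c : ℝ} (hc : 0 < c) (z : ℝ) :
    sig2 σlo σhi (c * z) = sig2 σlo σhi z := by
  simp only [sig2, mul_nonneg_iff_of_pos_left hc]

theorem Fflux_mul_of_pos (σlo σhi : ℝ) {c : ℝ} (hc : 0 < c) (z : ℝ) :
    Fflux σlo σhi (c * z) = c * Fflux σlo σhi z := by
  rw [Fflux, Fflux, sig2_mul_of_pos σlo σhi hc]
  ring

theorem sig2_Fflux {σlo σhi : ℝ} (hlo : 0 < σlo) (hσ : σlo ≤ σhi) (z : ℝ) :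
    sig2 σlo σhi (Fflux σlo σhi z) = sig2 σlo σhi z :=
  sig2_mul_of_pos σlo σhi (sig2_pos hlo hσ z) z

/-- Derived scheme for the discrete curvature `V = δ_h²U` and flux `W = F(V)`:
(i) `V^n = V^{n+1} + (Δt/2)·δ_h²W^{n+1}`;
(ii) `σ²(W^{n+1})·W^n = σ²(W^n)·(W^{n+1} + (Δt·σ²(W^{n+1})/2)·δ_h²W^{n+1})`;
(iii) `W^n = T(W^{n+1})`. -/
theorem stmt16 (σlo σhi h Δt : ℝ) (hσlo : 0 < σlo) (hσ : σlo ≤ σhi)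
    (hh : 0 < h) (hdt : 0 < Δt)
    (N : ℕ) (U : ℕ → ℤ → ℝ)
    (hU : ∀ n < N, ∀ i : ℤ, U n i = U (n + 1) i
      + Δt / 2 * Fflux σlo σhi
          ((U (n + 1) (i + 1) - 2 * U (n + 1) i + U (n + 1) (i - 1)) / h ^ 2))
    (V : ℕ → ℤ → ℝ)
    (hV : ∀ n (i : ℤ), V n i = (U n (i + 1) - 2 * U n i + U n (i - 1)) / h ^ 2)
    (W : ℕ → ℤ → ℝ)
    (hW : ∀ n (i : ℤ), W n i = Fflux σlo σhi (V n i)) :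
    ∀ n < N, ∀ i : ℤ,
      (V n i = V (n + 1) i
        + Δt / 2 * ((W (n + 1) (i + 1) - 2 * W (n + 1) i + W (n + 1) (i - 1)) / h ^ 2)) ∧
      (sig2 σlo σhi (W (n + 1) i) * W n i
        = sig2 σlo σhi (W n i) * (W (n + 1) i
            + Δt * sig2 σlo σhi (W (n + 1) i) / 2
              * ((W (n + 1) (i + 1) - 2 * W (n + 1) i + W (n + 1) (i - 1)) / h ^ 2))) ∧
      (W n i = Tmap σlo σhi h Δt (W (n + 1)) i) := by
  intro n hn i
  have hcurv : V n i = V (n + 1) i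
      + Δt / 2 * ((W (n + 1) (i + 1) - 2 * W (n + 1) i + W (n + 1) (i - 1)) / h ^ 2) := by
    have hstep : ∀ j, U n j = U (n + 1) j + Δt / 2 * W (n + 1) j := fun j => by
      rw [hW, hV, hU n hn j]
    rw [hV n, hV (n + 1), hstep, hstep, hstep]
    ring
  have hsig : ∀ m j, sig2 σlo σhi (W m j) = sig2 σlo σhi (V m j) := fun m j => by
    rw [hW, sig2_Fflux hσlo hσ]
  have hpos := sig2_pos hσlo hσ (W (n + 1) i)
  have hB : Bmap σlo σhi h Δt (W (n + 1)) i = sig2 σlo σhi (W (n + 1) i) * V n i := by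
    have hWV : W (n + 1) i = sig2 σlo σhi (W (n + 1) i) * V (n + 1) i := by
      rw [hsig, hW, Fflux]
    rw [Bmap, hcurv]
    linear_combination hWV
  refine ⟨hcurv, ?_, ?_⟩
  · change _ = sig2 σlo σhi (W n i) * Bmap σlo σhi h Δt (W (n + 1)) i
    rw [hB, hsig n i, hW n i, Fflux]
    ring
  · rw [Tmap, hB, Fflux_mul_of_pos σlo σhi hpos, mul_div_cancel_left₀ _ hpos.ne', hW n i]
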